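/- Let S be a completely Archimedean semiring. Then the relation 𝒴 is a congruence on S, and it is generalized additive idempotent pure: whenever a 𝒴 e with e ∈ E⁺(S), there is a positive integer n with na = (n+1)a. -/

import Mathlib

/-- A "semiring" in the sense of the paper: both reducts are semigroups
(no commutativity, no identities) and multiplication distributes over
addition on both sides. -/
class PSemiring (S : Type*) extends AddSemigroup S, Semigroup S where
  left_distrib : ∀ a b c : S, a * (b + c) = a * b + a * c
  right_distrib : ∀ a b c : S, (a + b) * c = a * c + b * c

namespace PSemiring

variable {S : Type*} [PSemiring S]

/-- `nmul n a` is the `(n+1)`-fold sum `a + ⋯ + a`; thus the positive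
multiple `m·a` of the paper is `nmul (m-1) a`. -/
def nmul : ℕ → S → S
  | 0, a => a
  | n + 1, a => nmul n a + a

/-- `a` is additively regular. -/
def AddRegular (a : S) : Prop := ∃ x, a + x + a = a

/-- `a` is a completely regular element. -/
def CompletelyRegularElem (a : S) : Prop :=
  ∃ x, a = a + x + a ∧ a + x = x + a ∧ a * (a + x) = a + x

/-- `S` is a quasi completely regular semiring. -/
def QuasiCompletelyRegular (S : Type*) [PSemiring S] : Prop :=
  ∀ a : S, ∃ n : ℕ, CompletelyRegularElem (nmul n a)

/-- `S` is a completely regular semiring. -/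
def CompletelyRegularSemiring (S : Type*) [PSemiring S] : Prop :=
  ∀ a : S, CompletelyRegularElem a

/-- `e` is an additive idempotent (i.e. `e ∈ E⁺(S)`). -/
def AddIdem (e : S) : Prop := e + e = e

/-- `V⁺(a)`, the set of additive inverses of `a`. -/
def Vplus (a : S) : Set S := {x | a + x + a = a ∧ x + a + x = x}

/-- `{a} ∪ (S + a)`. -/
def lset (a : S) : Set S := insert a {x | ∃ s, x = s + a}

/-- `{a} ∪ (a + S)`. -/
def rset (a : S) : Set S := insert a {x | ∃ s, x = a + s}

/-- `{a} ∪ (S + a) ∪ (a + S) ∪ (S + a + S)`. -/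
def jset (a : S) : Set S :=
  insert a ({x | ∃ s, x = s + a} ∪ {x | ∃ s, x = a + s} ∪ {x | ∃ s t, x = s + a + t})

/-- Green's relation `L⁺` on the additive reduct. -/
def GreenL (a b : S) : Prop := lset a = lset b

/-- Green's relation `R⁺` on the additive reduct. -/
def GreenR (a b : S) : Prop := rset a = rset b

/-- Green's relation `J⁺` on the additive reduct. -/
def GreenJ (a b : S) : Prop := jset a = jset b

/-- `n` is the least index such that the `(n+1)`-fold sum of `a` is additively
regular, i.e. `(n+1)·a` is the least additively regular positive multiple. -/
def LeastReg (a : S) (n : ℕ) : Prop :=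
  AddRegular (nmul n a) ∧ ∀ m < n, ¬ AddRegular (nmul m a)

/-- The relation `L*⁺`. -/
def LStar (a b : S) : Prop :=
  ∃ p q, LeastReg a p ∧ LeastReg b q ∧ GreenL (nmul p a) (nmul q b)

/-- The relation `R*⁺`. -/
def RStar (a b : S) : Prop :=
  ∃ p q, LeastReg a p ∧ LeastReg b q ∧ GreenR (nmul p a) (nmul q b)

/-- The relation `J*⁺`. -/
def JStar (a b : S) : Prop :=
  ∃ p q, LeastReg a p ∧ LeastReg b q ∧ GreenJ (nmul p a) (nmul q b)

/-- `H*⁺ = L*⁺ ∩ R*⁺`. -/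
def HStar (a b : S) : Prop := LStar a b ∧ RStar a b

/-- `D*⁺ = L*⁺ ∘ R*⁺` (relational composition). -/
def DStar (a b : S) : Prop := ∃ c, LStar a c ∧ RStar c b

/-- `z = 0_a`: `z = na + x` where `n` is the least positive integer with `na`
completely regular and `x` is the (unique) element with `na = na+x+na`,
`x = x+na+x` and `na+x = x+na`. -/
def IsZeroOf (a z : S) : Prop :=
  ∃ n x, (CompletelyRegularElem (nmul n a) ∧
      ∀ m < n, ¬ CompletelyRegularElem (nmul m a)) ∧
    nmul n a = nmul n a + x + nmul n a ∧ x = x + nmul n a + x ∧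
    nmul n a + x = x + nmul n a ∧ z = nmul n a + x

/-- The relation `𝒴`, relative to a choice `z` of the map `a ↦ 0_a`. -/
def Yrel (z : S → S) (a b : S) : Prop := Vplus (a + z a) = Vplus (b + z b)

/-- A (semiring) congruence. -/
structure IsCong (r : S → S → Prop) : Prop where
  refl : ∀ a, r a a
  symm : ∀ {a b}, r a b → r b a
  trans : ∀ {a b c}, r a b → r b c → r a c
  addl : ∀ (c : S) {a b}, r a b → r (c + a) (c + b)
  addr : ∀ (c : S) {a b}, r a b → r (a + c) (b + c)
  mull : ∀ (c : S) {a b}, r a b → r (c * a) (c * b)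
  mulr : ∀ (c : S) {a b}, r a b → r (a * c) (b * c)

/-- `r` is a b-lattice congruence: `S/r` is a b-lattice. -/
def IsBLatticeCong (r : S → S → Prop) : Prop :=
  IsCong r ∧ (∀ a : S, r (a * a) a) ∧ (∀ a : S, r (a + a) a) ∧
    ∀ a b : S, r (a + b) (b + a)

/-- `r` is the least b-lattice congruence. -/
def IsLeastBLatticeCong (r : S → S → Prop) : Prop :=
  IsBLatticeCong r ∧ ∀ r', IsBLatticeCong r' → ∀ a b, r a b → r' a b

/-- `r` is a skew-ring congruence: `S/r` is a semiring whose additive reduct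
is a group (expressed by solvability of both translation equations). -/
def IsSkewRingCong (r : S → S → Prop) : Prop :=
  IsCong r ∧ ∀ a b : S, (∃ x, r (a + x) b) ∧ ∃ y, r (y + a) b

/-- `r` is the least skew-ring congruence. -/
def IsLeastSkewRingCong (r : S → S → Prop) : Prop :=
  IsSkewRingCong r ∧ ∀ r', IsSkewRingCong r' → ∀ a b, r a b → r' a b

/-- `η` is a b-lattice-of-skew-rings congruence: `S/η` admits a congruence `ξ`
(given here as a congruence on `S` containing `η`) such that `(S/η)/ξ` is a
b-lattice and every `ξ`-class of `S/η` is a subsemiring whose additive reduct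
is a group. -/
def IsBLSRCong (η : S → S → Prop) : Prop :=
  IsCong η ∧ ∃ ξ : S → S → Prop, IsCong ξ ∧ (∀ a b, η a b → ξ a b) ∧
    (∀ a : S, ξ (a * a) a) ∧ (∀ a : S, ξ (a + a) a) ∧
    (∀ a b : S, ξ (a + b) (b + a)) ∧
    (∀ a b, ξ a b → ξ (a + b) a ∧ ξ (a * b) a) ∧
    ∀ a b, ξ a b → (∃ x, ξ x a ∧ η (a + x) b) ∧ ∃ y, ξ y a ∧ η (y + a) b

/-- `ν` is the least b-lattice-of-skew-rings congruence. -/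
def IsLeastBLSRCong (ν : S → S → Prop) : Prop :=
  IsBLSRCong ν ∧ ∀ η, IsBLSRCong η → ∀ a b, ν a b → η a b

/-- `r` is a completely regular semiring congruence: `S/r` is completely
regular. -/
def IsCRCong (r : S → S → Prop) : Prop :=
  IsCong r ∧ ∀ a : S, ∃ x, r a (a + x + a) ∧ r (a + x) (x + a) ∧
    r (a * (a + x)) (a + x)

/-- `ρ` is the least completely regular semiring congruence. -/
def IsLeastCRCong (r : S → S → Prop) : Prop :=
  IsCRCong r ∧ ∀ r', IsCRCong r' → ∀ a b, r a b → r' a b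

/-- `S` is quasi-orthodox. -/
def QuasiOrthodox (S : Type*) [PSemiring S] : Prop :=
  ∀ e f : S, AddIdem e → AddIdem f →
    ∃ n : ℕ, nmul n (e + f) = nmul (n + 1) (e + f)

/-- `S` is a completely Archimedean semiring. -/
def CompletelyArchimedean (S : Type*) [PSemiring S] : Prop :=
  QuasiCompletelyRegular S ∧ ∀ a b : S, JStar a b

/-- `r` is the least congruence containing the relation `τ`. -/
def IsLeastCongContaining (τ r : S → S → Prop) : Prop :=
  IsCong r ∧ (∀ a b, τ a b → r a b) ∧
    ∀ r', IsCong r' → (∀ a b, τ a b → r' a b) → ∀ a b, r a b → r' a b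

/-- `r` is a generalized additive idempotent pure congruence (purity part). -/
def GenAddIdemPure (r : S → S → Prop) : Prop :=
  ∀ a e : S, AddIdem e → r a e → ∃ n : ℕ, nmul n a = nmul (n + 1) a

/-- `τ^e`: `a = x + c + y`, `b = x + d + y` for some `(c,d) ∈ τ`, where each of
`x`, `y` may also be absent (i.e. `x, y ∈ S⁰`). -/
def relE (τ : S → S → Prop) (a b : S) : Prop :=
  ∃ c d, τ c d ∧ ((a = c ∧ b = d) ∨ (∃ x, a = x + c ∧ b = x + d) ∨
    (∃ y, a = c + y ∧ b = d + y) ∨ ∃ x y, a = x + c + y ∧ b = x + d + y)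

/-- `τ^♮`: the transitive closure of `(τ ∪ τ⁻¹ ∪ ε)^e`. -/
def natClosure (τ : S → S → Prop) : S → S → Prop :=
  Relation.TransGen (relE (fun a b => τ a b ∨ τ b a ∨ a = b))

/-- A completely simple semiring: the additive reduct is completely simple, with `idem a` the
identity of the maximal additive subgroup containing `a` and `inv a` the inverse of `a` in it,
and additive idempotents are multiplicatively idempotent. -/
class CSSemiring (T : Type*) extends PSemiring T where
  idem : T → T
  inv : T → T
  add_inv : ∀ a : T, a + inv a = idem a
  inv_add : ∀ a : T, inv a + a = idem a
  idem_add : ∀ a : T, idem a + a = a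
  add_idem : ∀ a : T, a + idem a = a
  inv_add_inv : ∀ a : T, inv a + a + inv a = inv a
  idem_sandwich : ∀ a b : T, idem (a + b + a) = idem a
  mul_self : ∀ e : T, e + e = e → e * e = e

namespace CSSemiring

/-- The completely simple semiring with reversed addition. -/
abbrev addOp {T : Type*} (i : CSSemiring T) : CSSemiring T where
  add a b := i.add b a
  add_assoc a b c := (i.add_assoc c b a).symm
  mul := i.mul
  mul_assoc := i.mul_assoc
  left_distrib a b c := i.left_distrib a c b
  right_distrib a b c := i.right_distrib b a c
  idem := i.idem
  inv := i.inv
  add_inv := i.inv_add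
  inv_add := i.add_inv
  idem_add := i.add_idem
  add_idem := i.idem_add
  inv_add_inv a := (i.add_assoc _ _ _).symm.trans (i.inv_add_inv a)
  idem_sandwich a b := (congrArg i.idem (i.add_assoc a b a).symm).trans (i.idem_sandwich a b)
  mul_self := i.mul_self

/-- The completely simple semiring with reversed multiplication. -/
abbrev mulOp {T : Type*} (i : CSSemiring T) : CSSemiring T where
  add := i.add
  add_assoc := i.add_assoc
  mul a b := i.mul b a
  mul_assoc a b c := (i.mul_assoc c b a).symm
  left_distrib a b c := i.right_distrib b c a
  right_distrib a b c := i.left_distrib c a b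
  idem := i.idem
  inv := i.inv
  add_inv := i.add_inv
  inv_add := i.inv_add
  idem_add := i.idem_add
  add_idem := i.add_idem
  inv_add_inv := i.inv_add_inv
  idem_sandwich := i.idem_sandwich
  mul_self := i.mul_self

variable {T : Type*} [CSSemiring T]

theorem idem_add_idem (a : T) : idem a + idem a = idem a := by
  nth_rw 2 [← add_inv a]
  rw [← add_assoc, idem_add, add_inv]

theorem idem_eq_self {e : T} (h : e + e = e) : idem e = e := by
  have h1 := idem_add e
  have h2 := inv_add e
  grind

theorem idem_add_right_add (a b : T) : idem (a + b) + a = a := by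
  have h1 := idem_sandwich a b
  have h2 := idem_add a
  have h3 := add_inv (a + b + a)
  have h4 : idem (a + b) + idem a = idem a := by
    rw [← h1, ← h3, ← add_assoc, ← add_assoc, idem_add]
  calc idem (a + b) + a = idem (a + b) + (idem a + a) := by rw [h2]
    _ = a := by rw [← add_assoc, h4, h2]

theorem add_idem_add_left (a b : T) : a + idem (b + a) = a :=
  @idem_add_right_add T (addOp ‹_›) a b

theorem add_add_eq_self {e : T} (s : T) (h : e + e = e)
    (h' : e + s + e + (e + s + e) = e + s + e) : e + s + e = e := by
  rw [← idem_eq_self h', idem_sandwich, idem_eq_self h]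

theorem mul_idem {e : T} (h : e + e = e) (c : T) : c * e + c * e = c * e := by
  rw [← PSemiring.left_distrib, h]

theorem mul_sandwich {e : T} (h : e + e = e) (t u : T) : t * e + u * e + t * e = t * e := by
  refine add_add_eq_self _ (mul_idem h t) ?_
  rw [← PSemiring.right_distrib, ← PSemiring.right_distrib, mul_idem h]

theorem mul_add_mul_add_mul {e : T} (h : e + e = e) (t u v : T) :
    t * e + u * e + v * e = t * e + v * e := by
  have h1 := mul_sandwich h v t
  have h2 := mul_sandwich h t (u + v)
  rw [PSemiring.right_distrib] at h2
  grind

theorem mul_add_mul_add_mul' {e : T} (h : e + e = e) (t u v : T) :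
    e * t + e * u + e * v = e * t + e * v :=
  @mul_add_mul_add_mul T (mulOp ‹_›) e h t u v

theorem add_mul_left_congr {a b : T} (hab : ∀ x : T, x + a = x + b) (c x : T) :
    x + c * a = x + c * b := by
  obtain ⟨e, he⟩ : ∃ e, e = idem a := ⟨_, rfl⟩
  obtain ⟨f, hf⟩ : ∃ f, f = idem b := ⟨_, rfl⟩
  have he2 : e + e = e := by rw [he, idem_add_idem]
  have hf2 : f + f = f := by rw [hf, idem_add_idem]
  have hea : e + a = a := by rw [he, idem_add]
  have hae : a + e = a := by rw [he, add_idem]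
  have hfb : f + b = b := by rw [hf, idem_add]
  have hbf : b + f = b := by rw [hf, add_idem]
  have han : a + inv a = e := by rw [he, add_inv]
  have hnb : inv b + b = f := by rw [hf, inv_add]
  have hna : inv a + a = e := by rw [he, inv_add]
  have hfa : f + a = b := by rw [hab, hfb]
  have heb : e + b = a := by rw [← hab, hea]
  have hfe : f + e = f := by
    have : b + e = b := by rw [← hfa, add_assoc, hae]
    rw [← hnb, add_assoc, this]
  have hef : e + f = e := by
    have : a + f = a := by rw [← heb, add_assoc, hbf]
    rw [← hna, add_assoc, this]
  have hxe : ∀ x, x + e = x + f := fun x => by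
    have : b + inv a = f + e := by rw [← hfa, add_assoc, han]
    rw [← han, ← add_assoc, hab, add_assoc, this, hfe]
  have hEF : ∀ x, x + (c * e + e) = x + (c * f + f) := fun x => by
    obtain ⟨s, hs⟩ : ∃ s, s = idem (c + x) := ⟨_, rfl⟩
    have hs2 : s + s = s := by rw [hs, idem_add_idem]
    have hsc : s + c = c := by rw [hs, idem_add_right_add]
    have hxs : x + s = x := by rw [hs, add_idem_add_left]
    have hss := mul_self s hs2
    have key : ∀ g : T, g + g = g → s + (c * g + g) = s + s * g + g := fun g hg => by
      have h1 := mul_add_mul_add_mul hg s c g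
      rw [← PSemiring.right_distrib s c g, hsc, mul_self g hg] at h1
      rw [h1, add_assoc]
    have hq : s + s * f = s + s * e := by
      have h1 := mul_add_mul_add_mul' hs2 s e f
      rw [add_assoc, ← PSemiring.left_distrib s e f, hef, hss] at h1
      exact h1.symm
    rw [← hxs, add_assoc, add_assoc, key e he2, key f hf2, hq, hxe (s + s * e)]
  have hEa : c * e + e + c * a = c * a := by
    have h1 := mul_sandwich he2 c e
    rw [mul_self e he2] at h1
    have h2 : c * a = c * e + c * a := by rw [← PSemiring.left_distrib, hea]
    rw [h2, ← add_assoc, h1]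
  have hFe : c * f + f + c * e = c * f := by
    have h1 := hEF (c * f)
    have h2 := mul_idem hf2 c
    have h3 := mul_sandwich he2 c e
    rw [mul_self e he2] at h3
    have h4 : c * f + c * e = c * f := by rw [← PSemiring.left_distrib, hfe]
    grind
  have hca : c * e + c * a = c * a := by rw [← PSemiring.left_distrib, hea]
  have hcb : c * f + c * a = c * b := by rw [← PSemiring.left_distrib, hfa]
  calc x + c * a = x + (c * e + e) + c * a := by rw [add_assoc, hEa]
    _ = x + (c * f + f) + (c * e + c * a) := by rw [hEF, hca]
    _ = x + (c * f + f + c * e) + c * a := by simp only [add_assoc]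
    _ = x + c * b := by rw [hFe, add_assoc, hcb]

/-- `a` and `b` cannot be told apart by adding elements on both sides. -/
def Indist (a b : T) : Prop := ∀ x y : T, x + a + y = x + b + y

theorem Indist.exists_factor {a b : T} (h : Indist a b) :
    ∃ m : T, (∀ x, x + a = x + m) ∧ ∀ y, m + y = b + y := by
  refine ⟨b + idem a, fun x => ?_, fun y => ?_⟩
  · rw [← add_assoc, ← h, add_assoc, add_idem]
  · have h1 := h (idem b) (idem a + y)
    have h2 := h (idem b) y
    have h3 := idem_add b
    have h4 := add_idem a
    grind

theorem Indist.mul_left {a b : T} (h : Indist a b) (c : T) : Indist (c * a) (c * b) := by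
  obtain ⟨m, h1, h2⟩ := h.exists_factor
  intro x y
  have h3 : c * m + y = c * b + y := @add_mul_left_congr T (addOp ‹_›) m b h2 c y
  rw [add_mul_left_congr h1, add_assoc, h3, add_assoc]

theorem Indist.mul_right {a b : T} (h : Indist a b) (c : T) : Indist (a * c) (b * c) :=
  @Indist.mul_left T (mulOp ‹_›) a b h c

theorem Indist.of_Vplus_eq {a b : T} (h : Vplus a = Vplus b) : Indist a b := by
  intro x y
  obtain ⟨c, hc⟩ : ∃ c, c = x + a + y := ⟨_, rfl⟩
  have hn := inv_add_inv c
  have hw : y + inv c + x ∈ Vplus a := by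
    constructor
    · have h1 : a + (y + inv c + x) + (a + (y + inv c + x)) = a + (y + inv c + x) := by grind
      have h2 := idem_add_right_add a (y + inv c + x)
      rwa [idem_eq_self h1] at h2
    · grind
  rw [h] at hw
  have h3 := hw.2
  have h4 : idem c + x = x := by rw [hc, add_assoc]; exact idem_add_right_add _ _
  have h5 : y + idem c = y := by rw [hc]; exact add_idem_add_left _ _
  have h6 := add_inv c
  have h7 := inv_add c
  have h8 := idem_add c
  rw [← hc]
  have h9 : c + inv c + (x + b + y) + inv c + c = c + inv c + c := by
    calc _ = x + a + (y + inv c + x + b + (y + inv c + x)) + a + y := by grind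
      _ = _ := by rw [h3]; grind
  grind

theorem Indist.Vplus_subset {a b : T} (h : Indist a b) : Vplus a ⊆ Vplus b := by
  rintro w ⟨-, h2⟩
  have h3 : w + b + w = w := by rw [← h, h2]
  have h4 : b + w + (b + w) = b + w := by grind
  have h5 := idem_add_right_add b w
  rw [idem_eq_self h4] at h5
  exact ⟨h5, h3⟩

theorem Vplus_eq_iff {a b : T} : Vplus a = Vplus b ↔ Indist a b :=
  ⟨.of_Vplus_eq, fun h =>
    h.Vplus_subset.antisymm (Indist.Vplus_subset fun x y => (h x y).symm)⟩

end CSSemiring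

theorem nmul_add_comm (n : ℕ) (a : S) : nmul n a + a = a + nmul n a := by
  induction n with
  | zero => rfl
  | succ n ih => rw [nmul, ← add_assoc, ← ih]

theorem exists_add_nmul_add (n : ℕ) (a : S) : ∃ u v, nmul n (a + a + a) = u + a + v := by
  induction n with
  | zero => exact ⟨a, a, rfl⟩
  | succ n ih => exact ⟨nmul n (a + a + a) + a, a, by simp only [nmul, add_assoc]⟩

theorem exists_nmul_eq_add (n : ℕ) (a b : S) : ∃ t, nmul n (a + b) = a + t := by
  cases n with
  | zero => exact ⟨b, rfl⟩
  | succ n => exact ⟨b + nmul n (a + b), by rw [nmul, nmul_add_comm, add_assoc]⟩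

theorem exists_nmul_eq_add' (n : ℕ) (a b : S) : ∃ t, nmul n (a + b) = t + b := by
  cases n with
  | zero => exact ⟨a, rfl⟩
  | succ n => exact ⟨nmul n (a + b) + a, by rw [nmul, add_assoc]⟩

theorem exists_eq_add_nmul {b u v : S} (h : b = u + b + v) (k : ℕ) :
    ∃ w, b = w + b + nmul k v := by
  induction k with
  | zero => exact ⟨u, h⟩
  | succ k ih =>
    obtain ⟨w, hw⟩ := ih
    refine ⟨w + u, ?_⟩
    rw [nmul, nmul_add_comm]
    calc b = w + (u + b + v) + nmul k v := by rw [← h, ← hw]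
      _ = _ := by simp only [add_assoc]

theorem exists_eq_nmul_add {b u v : S} (h : b = u + b + v) (k : ℕ) :
    ∃ w, b = nmul k u + b + w := by
  induction k with
  | zero => exact ⟨v, h⟩
  | succ k ih =>
    obtain ⟨w, hw⟩ := ih
    refine ⟨v + w, ?_⟩
    rw [nmul]
    calc b = nmul k u + (u + b + v) + w := by rw [← h, ← hw]
      _ = _ := by simp only [add_assoc]

/-- `e` is the identity of a subgroup of the additive reduct in which `a` and `y` are mutually
inverse. -/
structure IsGroupInv (a e y : S) : Prop where
  add_inv : a + y = e
  inv_add : y + a = e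
  idem_add : e + a = a
  add_idem : a + e = a
  inv_add_inv : y + a + y = y

theorem IsGroupInv.addRegular {a e y : S} (h : IsGroupInv a e y) : AddRegular a :=
  ⟨y, by rw [h.add_inv, h.idem_add]⟩

theorem IsGroupInv.addIdem {a e y : S} (h : IsGroupInv a e y) : e + e = e := by
  rw [← h.add_inv, ← add_assoc, h.add_inv, h.idem_add, h.add_inv]

theorem addRegular_of_idem {e : S} (h : e + e = e) : AddRegular e :=
  ⟨e, by rw [h, h]⟩

theorem CompletelyRegularElem.addRegular {a : S} (h : CompletelyRegularElem a) :
    AddRegular a := by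
  obtain ⟨x, hx, -⟩ := h
  exact ⟨x, hx.symm⟩

theorem QuasiCompletelyRegular.mul_self (hQ : QuasiCompletelyRegular S) {e : S}
    (h : e + e = e) : e * e = e := by
  obtain ⟨n, x, h1, h2, h3⟩ := hQ e
  have hn : nmul n e = e := by
    clear h1 h2 h3
    induction n with
    | zero => rfl
    | succ n ih => rw [nmul, ih, h]
  rw [hn] at h1 h2 h3
  have : e + x = e := by
    calc e + x = e + e + x := by rw [h]
      _ = e := by rw [add_assoc, h2, ← add_assoc, ← h1]
  rwa [this] at h3

theorem QuasiCompletelyRegular.exists_isGroupInv (hQ : QuasiCompletelyRegular S) {b u v : S}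
    (h : b = u + (b + b) + v) : ∃ e y, IsGroupInv b e y := by
  obtain ⟨w, hw⟩ : ∃ w, b = b + b + w := by
    obtain ⟨k, x, h1, h2, -⟩ := hQ (b + v)
    obtain ⟨p, hp⟩ := exists_eq_add_nmul (b := b) (u := u) (v := b + v) (by grind) k
    obtain ⟨t, ht⟩ := exists_nmul_eq_add k b v
    have h3 : b + (x + nmul k (b + v)) = b := by
      calc _ = p + b + nmul k (b + v) + (x + nmul k (b + v)) := by rw [← hp]
        _ = p + b + (nmul k (b + v) + x + nmul k (b + v)) := by simp only [add_assoc]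
        _ = b := by rw [← h1, ← hp]
    rw [← h2, ht] at h3
    exact ⟨t + x, by rw [add_assoc, ← add_assoc b t, h3]⟩
  obtain ⟨w', hw'⟩ : ∃ w, b = w + b + b := by
    obtain ⟨k, x, h1, h2, -⟩ := hQ (u + b)
    obtain ⟨p, hp⟩ := exists_eq_nmul_add (b := b) (u := u + b) (v := v) (by grind) k
    obtain ⟨t, ht⟩ := exists_nmul_eq_add' k u b
    have h3 : nmul k (u + b) + x + b = b := by
      calc _ = nmul k (u + b) + x + (nmul k (u + b) + b + p) := by rw [← hp]
        _ = nmul k (u + b) + x + nmul k (u + b) + b + p := by simp only [add_assoc]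
        _ = b := by rw [← h1, ← hp]
    rw [h2, ht] at h3
    exact ⟨x + t, by rw [add_assoc x t, h3]⟩
  have h1 : w' + b = b + w := by
    calc w' + b = w' + (b + b + w) := by rw [← hw]
      _ = w' + b + b + w := by simp only [add_assoc]
      _ = b + w := by rw [← hw']
  have h2 : b + w + b = b := by rw [← h1, ← hw']
  have h3 : w' + b + w + b = b + w := by rw [add_assoc w', add_assoc w', h2, h1]
  refine ⟨b + w, w' + b + w, ?_, h3, h2, ?_, ?_⟩
  · rw [h1, ← add_assoc, ← add_assoc, ← hw]
  · rw [← add_assoc, ← hw]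
  · rw [h3, h1, ← add_assoc, ← add_assoc, h2]

theorem CompletelyArchimedean.exists_eq_add_add (hS : CompletelyArchimedean S) {b : S}
    (hb : AddRegular b) (c : S) : ∃ u v, b = u + c + v := by
  obtain ⟨n, hn⟩ := hS.1 (c + c + c)
  obtain ⟨u, v, huv⟩ := exists_add_nmul_add n c
  have hzero : ∀ {a p}, AddRegular a → LeastReg (S := S) a p → p = 0 := fun {a p} ha hp => by
    by_contra h
    exact hp.2 0 (Nat.pos_of_ne_zero h) ha
  obtain ⟨p, q, hp, hq, hpq⟩ := hS.2 b (nmul n (c + c + c))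
  rw [hzero hb hp, hzero hn.addRegular hq] at hpq
  have hmem : b ∈ jset (nmul n (c + c + c)) := by
    have : jset b = jset (nmul n (c + c + c)) := hpq
    rw [← this]
    exact Set.mem_insert _ _
  rw [huv] at hmem
  rcases hmem with h | (⟨s, h⟩ | ⟨s, h⟩) | ⟨s, t, h⟩
  · exact ⟨u, v, h⟩
  · exact ⟨s + u, v, by rw [h]; simp only [add_assoc]⟩
  · exact ⟨u, v + s, by rw [h]; simp only [add_assoc]⟩
  · exact ⟨s + u, v + t, by rw [h]; simp only [add_assoc]⟩

theorem CompletelyArchimedean.exists_isGroupInv (hS : CompletelyArchimedean S) {b : S}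
    (hb : AddRegular b) : ∃ e y, IsGroupInv b e y := by
  obtain ⟨u, v, h⟩ := hS.exists_eq_add_add hb (b + b)
  exact hS.1.exists_isGroupInv h

theorem CompletelyArchimedean.addRegular_add_right (hS : CompletelyArchimedean S) {b : S}
    (hb : AddRegular b) (s : S) : AddRegular (b + s) := by
  obtain ⟨u, v, h⟩ := hS.exists_eq_add_add hb (b + s + (b + s))
  obtain ⟨e, y, hy⟩ := hS.1.exists_isGroupInv (b := b + s) (u := u) (v := v + s)
    (by rw [← add_assoc, ← h])
  exact hy.addRegular

theorem CompletelyArchimedean.addRegular_add_left (hS : CompletelyArchimedean S) {b : S}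
    (hb : AddRegular b) (s : S) : AddRegular (s + b) := by
  obtain ⟨u, v, h⟩ := hS.exists_eq_add_add hb (s + b + (s + b))
  obtain ⟨e, y, hy⟩ := hS.1.exists_isGroupInv (b := s + b) (u := s + u) (v := v)
    (by rw [add_assoc s u, add_assoc s, ← h])
  exact hy.addRegular

theorem mul_idem_add {e : S} (h : e + e = e) (s : S) : s * e + s * e = s * e := by
  rw [← left_distrib, h]

theorem idem_mul_add {e : S} (h : e + e = e) (s : S) : e * s + e * s = e * s := by
  rw [← right_distrib, h]

theorem CompletelyArchimedean.addRegular_mul_right (hS : CompletelyArchimedean S) {b : S}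
    (hb : AddRegular b) (s : S) : AddRegular (b * s) := by
  obtain ⟨e, y, hy⟩ := hS.exists_isGroupInv hb
  rw [← hy.add_idem, right_distrib]
  exact hS.addRegular_add_left (addRegular_of_idem (idem_mul_add hy.addIdem s)) _

/-- Every additive idempotent is primitive. -/
theorem CompletelyArchimedean.eq_of_le (hS : CompletelyArchimedean S) {e g : S}
    (he : e + e = e) (hg : g + g = g) (h1 : e + g = g) (h2 : g + e = g) : g = e := by
  obtain ⟨u, v, h⟩ := hS.exists_eq_add_add (addRegular_of_idem he) g
  obtain ⟨k, y, hy⟩ := hS.exists_isGroupInv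
    (hS.addRegular_add_left (addRegular_of_idem hg) (e + u))
  have h4 := hy.inv_add
  have h5 := hy.idem_add
  have h6 : e = e + u + g + v := by rw [add_assoc e, add_assoc e, ← h, he]
  have h7 : k + e = e := by rw [h6, ← add_assoc, h5]
  have h8 : k + g = k := by rw [← h4, add_assoc, add_assoc, hg]
  have h9 : k + e = k := by rw [← h8, add_assoc, h2]
  rw [← h1, ← h7, h9, h8]

theorem CompletelyArchimedean.add_eq_of_eq_add (hS : CompletelyArchimedean S) {p q s : S}
    (hp : AddRegular p) (hq : q + q = q) (h : q = s + p) : p + q = p := by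
  obtain ⟨e, y, hy⟩ := hS.exists_isGroupInv hp
  have h1 := hy.add_idem
  have h2 := hy.addIdem
  have h3 : q + e = q := by rw [h, add_assoc, h1]
  have h4 : e + q = e := hS.eq_of_le h2 (by grind) (by grind) (by grind)
  rw [← h1, add_assoc, h4]

/-- Right translations of the kernel map it into a single `L⁺`-class. -/
theorem CompletelyArchimedean.add_add_idem (hS : CompletelyArchimedean S) {a e y c : S}
    (he : e + e = e) (hy : e = y + a) (hc : AddRegular c) : c + a + e = c + a := by
  obtain ⟨h, n, hn⟩ := hS.exists_isGroupInv (hS.addRegular_add_right hc a)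
  have hh := hn.addIdem
  have hR : ∀ s, AddRegular (h * s) := fun s => addRegular_of_idem (idem_mul_add hh s)
  have hR' : ∀ s, AddRegular (s * e) := fun s => addRegular_of_idem (mul_idem_add he s)
  have h1 : h = h * n + h * c + h * a := by
    rw [← left_distrib, ← left_distrib, add_assoc, hn.inv_add, hS.1.mul_self hh]
  have h2 : h * e = h * y + h * a := by rw [← left_distrib, hy]
  have h3 : h * a + h * e = h * a := hS.add_eq_of_eq_add (hR a) (idem_mul_add hh e) h2
  have h4 : h + h * e = h := by
    calc h + h * e = h * n + h * c + h * a + h * e := congrArg (· + _) h1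
      _ = h * n + h * c + h * a := by rw [add_assoc _ (h * a), h3]
      _ = h := h1.symm
  have h5 : e = y * e + a * e := by rw [← right_distrib, ← hy, hS.1.mul_self he]
  have h6 : h * e = n * e + c * e + a * e := by
    rw [← right_distrib, ← right_distrib, add_assoc, hn.inv_add]
  have h7 : a * e + e = a * e := hS.add_eq_of_eq_add (hR' a) he h5
  have h8 : h * e + e = h * e := by rw [h6, add_assoc, h7]
  have h9 : h + e = h := by rw [← h4, add_assoc, h8]
  rw [← hn.add_idem, add_assoc _ h, h9]

/-- The kernel of a completely Archimedean semiring: its additively regular elements. -/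
abbrev Kernel (S : Type*) [PSemiring S] := {a : S // AddRegular a}

/-- The kernel of a completely Archimedean semiring is a completely simple semiring. -/
noncomputable abbrev CompletelyArchimedean.kernelCSSemiring (hS : CompletelyArchimedean S) :
    CSSemiring (Kernel S) :=
  have hG : ∀ a : Kernel S, ∃ p : Kernel S × Kernel S, IsGroupInv a.1 p.1.1 p.2.1 := fun a => by
    obtain ⟨e, y, h⟩ := hS.exists_isGroupInv a.2
    have hy : AddRegular y := ⟨a.1, h.inv_add_inv⟩
    exact ⟨(⟨e, addRegular_of_idem h.addIdem⟩, ⟨y, hy⟩), h⟩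
  { add := fun a b => ⟨a.1 + b.1, hS.addRegular_add_right a.2 _⟩
    add_assoc := fun a b c => Subtype.ext (add_assoc a.1 b.1 c.1)
    mul := fun a b => ⟨a.1 * b.1, hS.addRegular_mul_right a.2 _⟩
    mul_assoc := fun a b c => Subtype.ext (mul_assoc a.1 b.1 c.1)
    left_distrib := fun a b c => Subtype.ext (left_distrib a.1 b.1 c.1)
    right_distrib := fun a b c => Subtype.ext (right_distrib a.1 b.1 c.1)
    idem := fun a => (hG a).choose.1
    inv := fun a => (hG a).choose.2
    add_inv := fun a => Subtype.ext (hG a).choose_spec.add_inv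
    inv_add := fun a => Subtype.ext (hG a).choose_spec.inv_add
    idem_add := fun a => Subtype.ext (hG a).choose_spec.idem_add
    add_idem := fun a => Subtype.ext (hG a).choose_spec.add_idem
    inv_add_inv := fun a => Subtype.ext (hG a).choose_spec.inv_add_inv
    idem_sandwich := fun a b => Subtype.ext <| by
      have h1 := (hG a).choose_spec
      have h2 := (hG ⟨a.1 + b.1 + a.1, hS.addRegular_add_left a.2 _⟩).choose_spec
      refine hS.eq_of_le h1.addIdem h2.addIdem ?_ ?_
      · refine (congrArg _ h2.add_inv.symm).trans (.trans ?_ h2.add_inv)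
        simp only [← add_assoc, h1.idem_add]
      · refine (congrArg (· + _) h2.inv_add.symm).trans (.trans ?_ h2.inv_add)
        simp only [add_assoc, h1.add_idem]
    mul_self := fun e he => Subtype.ext (hS.1.mul_self (congrArg Subtype.val he)) }

theorem IsZeroOf.properties {a e : S} (h : IsZeroOf a e) :
    e + e = e ∧ (∃ y, e = a + y) ∧ (∃ y, e = y + a) := by
  obtain ⟨n, x, -, h1, h2, h3, rfl⟩ := h
  refine ⟨by rw [← add_assoc, ← h1], ?_, ?_⟩
  · cases n with
    | zero => exact ⟨x, rfl⟩
    | succ n => exact ⟨nmul n a + x, by rw [nmul, nmul_add_comm, add_assoc]⟩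
  · rw [h3]
    cases n with
    | zero => exact ⟨x, rfl⟩
    | succ n => exact ⟨x + nmul n a, by rw [nmul, add_assoc]⟩

/-- `a` and `b` cannot be told apart by adding kernel elements on both sides. -/
def KernelIndist (a b : S) : Prop :=
  ∀ x y : S, AddRegular x → AddRegular y → x + a + y = x + b + y

theorem CompletelyArchimedean.kernelIndist_iff (hS : CompletelyArchimedean S) (a b : Kernel S) :
    KernelIndist a.1 b.1 ↔ @CSSemiring.Indist _ hS.kernelCSSemiring a b :=
  ⟨fun h x y => Subtype.ext (h x.1 y.1 x.2 y.2),
    fun h x y hx hy => congrArg Subtype.val (h ⟨x, hx⟩ ⟨y, hy⟩)⟩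

theorem CompletelyArchimedean.Vplus_eq_iff (hS : CompletelyArchimedean S) (a b : Kernel S) :
    Vplus a.1 = Vplus b.1 ↔ KernelIndist a.1 b.1 := by
  let _ := hS.kernelCSSemiring
  rw [hS.kernelIndist_iff, ← CSSemiring.Vplus_eq_iff]
  have hmem : ∀ (c w : Kernel S), w ∈ Vplus c ↔ w.1 ∈ Vplus c.1 := fun c w =>
    ⟨fun h => ⟨congrArg Subtype.val h.1, congrArg Subtype.val h.2⟩,
      fun h => ⟨Subtype.ext h.1, Subtype.ext h.2⟩⟩
  constructor
  · intro h
    ext1 w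
    rw [hmem, hmem, h]
  · intro h
    have hreg : ∀ {c w : S}, w ∈ Vplus c → AddRegular w := fun {c w} hw => ⟨c, hw.2⟩
    ext1 w
    constructor
    · intro hw
      exact (hmem b ⟨w, hreg hw⟩).1 (h ▸ (hmem a ⟨w, hreg hw⟩).2 hw)
    · intro hw
      exact (hmem a ⟨w, hreg hw⟩).1 (h ▸ (hmem b ⟨w, hreg hw⟩).2 hw)

variable {z : S → S}

theorem CompletelyArchimedean.addRegular_add_zero (hS : CompletelyArchimedean S)
    (hz : ∀ a, IsZeroOf a (z a)) (a : S) : AddRegular (a + z a) :=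
  hS.addRegular_add_left (addRegular_of_idem (hz a).properties.1) _

theorem CompletelyArchimedean.add_add_zero (hS : CompletelyArchimedean S)
    (hz : ∀ a, IsZeroOf a (z a)) (a : S) {x : S} (hx : AddRegular x) :
    x + (a + z a) = x + a := by
  obtain ⟨h1, -, y, hy⟩ := (hz a).properties
  rw [← add_assoc, hS.add_add_idem h1 hy hx]

theorem CompletelyArchimedean.add_mul_zero (hS : CompletelyArchimedean S)
    (hz : ∀ a, IsZeroOf a (z a)) (c a : S) {x : S} (hx : AddRegular x) :
    x + (c + z c) * (a + z a) = x + c * a := by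
  obtain ⟨h1, -, y, hy⟩ := (hz a).properties
  obtain ⟨h3, -, w, hw⟩ := (hz c).properties
  have h5 : x + c * (a + z a) = x + c * a := by
    rw [left_distrib, ← add_assoc]
    exact hS.add_add_idem (y := c * y) (mul_idem_add h1 c) (by rw [← left_distrib, ← hy]) hx
  rw [right_distrib, ← add_assoc, ← h5]
  exact hS.add_add_idem (y := w * (a + z a)) (idem_mul_add h3 _)
    (by rw [← right_distrib, ← hw]) hx

theorem CompletelyArchimedean.yrel_iff (hS : CompletelyArchimedean S)
    (hz : ∀ a, IsZeroOf a (z a)) (a b : S) : Yrel z a b ↔ KernelIndist a b := by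
  rw [Yrel, hS.Vplus_eq_iff ⟨_, hS.addRegular_add_zero hz a⟩ ⟨_, hS.addRegular_add_zero hz b⟩]
  refine forall₄_congr fun x y hx hy => ?_
  simp only [hS.add_add_zero hz _ hx]

theorem CompletelyArchimedean.kernelIndist_add_zero (hS : CompletelyArchimedean S)
    (hz : ∀ a, IsZeroOf a (z a)) {a b : S} (h : KernelIndist a b) :
    KernelIndist (a + z a) (b + z b) := fun x y hx hy => by
  rw [hS.add_add_zero hz _ hx, hS.add_add_zero hz _ hx, h x y hx hy]

theorem CompletelyArchimedean.kernelIndist_mul_left (hS : CompletelyArchimedean S)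
    (hz : ∀ a, IsZeroOf a (z a)) {a b : S} (h : KernelIndist a b) (c : S) :
    KernelIndist (c * a) (c * b) := fun x y hx hy => by
  rw [← hS.add_mul_zero hz c a hx, ← hS.add_mul_zero hz c b hx]
  have hr := hS.addRegular_add_zero hz
  have h1 := (hS.kernelIndist_iff ⟨_, hr a⟩ ⟨_, hr b⟩).1 (hS.kernelIndist_add_zero hz h)
  let _ := hS.kernelCSSemiring
  exact (hS.kernelIndist_iff _ _).2 (h1.mul_left ⟨_, hr c⟩) x y hx hy

theorem CompletelyArchimedean.kernelIndist_mul_right (hS : CompletelyArchimedean S)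
    (hz : ∀ a, IsZeroOf a (z a)) {a b : S} (h : KernelIndist a b) (c : S) :
    KernelIndist (a * c) (b * c) := fun x y hx hy => by
  rw [← hS.add_mul_zero hz a c hx, ← hS.add_mul_zero hz b c hx]
  have hr := hS.addRegular_add_zero hz
  have h1 := (hS.kernelIndist_iff ⟨_, hr a⟩ ⟨_, hr b⟩).1 (hS.kernelIndist_add_zero hz h)
  let _ := hS.kernelCSSemiring
  exact (hS.kernelIndist_iff _ _).2 (h1.mul_right ⟨_, hr c⟩) x y hx hy

theorem CompletelyArchimedean.exists_nmul_eq (hS : CompletelyArchimedean S) {a e : S}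
    (he : AddIdem e) (h : KernelIndist a e) : ∃ n, nmul n a = nmul (n + 1) a := by
  have he' : e + e = e := he
  have hnmul : ∀ n, KernelIndist (nmul n a) e := fun n => by
    induction n with
    | zero => exact h
    | succ n ih =>
      intro x y hx hy
      have h1 := h (x + nmul n a) y (hS.addRegular_add_right hx _) hy
      have h2 := ih x (e + y) hx (hS.addRegular_add_left hy _)
      rw [nmul, ← add_assoc, h1, add_assoc, h2, ← add_assoc, add_assoc x e e, he']
  obtain ⟨n, hn⟩ := hS.1 a
  obtain ⟨k, y, hy⟩ := hS.exists_isGroupInv hn.addRegular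
  have hk := addRegular_of_idem hy.addIdem
  have h1 := (hnmul n k k hk hk).trans (hnmul (n + 1) k k hk hk).symm
  refine ⟨n, ?_⟩
  rw [hy.idem_add, hy.add_idem] at h1
  rw [h1, nmul, ← add_assoc, hy.idem_add, nmul_add_comm, add_assoc, hy.add_idem]

end PSemiring

open PSemiring

/-- On a completely Archimedean semiring `S`, the relation `𝒴`
is a congruence, and it is generalized additive idempotent pure. -/
theorem yrel_cong_and_pure {S : Type*} [PSemiring S]
    (hS : CompletelyArchimedean S) (z : S → S) (hz : ∀ a, IsZeroOf a (z a)) :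
    IsCong (Yrel z) ∧ GenAddIdemPure (Yrel z) := by
  refine ⟨⟨fun _ => rfl, fun h => Eq.symm h, fun h h' => Eq.trans h h', ?_, ?_, ?_, ?_⟩, ?_⟩
  · intro c a b h
    rw [hS.yrel_iff hz] at h ⊢
    intro x y hx hy
    rw [← add_assoc, ← add_assoc, h _ y (hS.addRegular_add_right hx c) hy]
  · intro c a b h
    rw [hS.yrel_iff hz] at h ⊢
    intro x y hx hy
    have h1 := h x (c + y) hx (hS.addRegular_add_left hy c)
    simpa only [add_assoc] using h1
  · intro c a b h
    rw [hS.yrel_iff hz] at h ⊢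
    exact hS.kernelIndist_mul_left hz h c
  · intro c a b h
    rw [hS.yrel_iff hz] at h ⊢
    exact hS.kernelIndist_mul_right hz h c
  · intro a e he h
    exact hS.exists_nmul_eq he ((hS.yrel_iff hz a e).1 h)
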